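/- Let N be a finite set, A, B, C pairwise disjoint subsets of N with A, B nonempty, and let θ be a representation of u_{⟨A,B|C⟩} with terms u_θ(s,t). For 1 ≤ s0 ≤ |A|−1, θ is (s0,*)-separable if and only if Γ(u_θ(s0,t)) = bΓ(u_θ(s0,t−1)) for all 1 ≤ t ≤ |B|−1. Similarly, for 1 ≤ t0 ≤ |B|−1, θ is (*,t0)-separable if and only if Γ(u_θ(s,t0)) = aΓ(u_θ(s−1,t0)) for all 1 ≤ s ≤ |A|−1. -/

import Mathlib

open Finset

/-- The semi-elementary imset `u_{⟨A,B|C⟩}` as a `ℤ`-valued function on finite sets. -/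
def uim {α : Type*} [DecidableEq α] (A B C : Finset α) : Finset α → ℤ := fun S =>
  (if S = A ∪ B ∪ C then 1 else 0) + (if S = C then 1 else 0)
    - (if S = A ∪ C then 1 else 0) - (if S = B ∪ C then 1 else 0)

/-- A representation of `u_{⟨A,B|C⟩}` recorded through its terms
`u_θ(s,t) = u_{⟨a_{st}, b_{st} | Γ_{st}⟩}`, one from each class `E^{s,t}_{⟨A,B|C⟩}`
(i.e. with `|A ∩ Γ_{st}| = s`, `|B ∩ Γ_{st}| = t`) for `0 ≤ s ≤ |A|−1`, `0 ≤ t ≤ |B|−1`,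
summing to `u_{⟨A,B|C⟩}`. -/
def IsTermRep {α : Type*} [DecidableEq α] (A B C : Finset α)
    (as bs : ℕ → ℕ → α) (Γs : ℕ → ℕ → Finset α) : Prop :=
  (∀ s t, s < A.card → t < B.card →
      as s t ∈ A ∧ bs s t ∈ B ∧ C ⊆ Γs s t ∧ Γs s t ⊆ A ∪ B ∪ C ∧
      as s t ∉ Γs s t ∧ bs s t ∉ Γs s t ∧
      (A ∩ Γs s t).card = s ∧ (B ∩ Γs s t).card = t) ∧
  ∀ S : Finset α, uim A B C S =
      ∑ s ∈ Finset.range A.card, ∑ t ∈ Finset.range B.card,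
        uim {as s t} {bs s t} (Γs s t) S

/-- The representation with terms `u_θ(s,t)` is `(s₀,*)`-separable: for some `A₀ ⊆ A` with
`|A₀| = s₀`, the terms with `s < s₀` sum to `u_{⟨A₀,B|C⟩}` and the terms with `s ≥ s₀`
sum to `u_{⟨A∖A₀,B|A₀∪C⟩}`. -/
def SepA {α : Type*} [DecidableEq α] (A B C : Finset α)
    (as bs : ℕ → ℕ → α) (Γs : ℕ → ℕ → Finset α) (s₀ : ℕ) : Prop :=
  ∃ A₀ ⊆ A, A₀.card = s₀ ∧
    (∀ S : Finset α, uim A₀ B C S =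
      ∑ s ∈ Finset.range s₀, ∑ t ∈ Finset.range B.card,
        uim {as s t} {bs s t} (Γs s t) S) ∧
    (∀ S : Finset α, uim (A \ A₀) B (A₀ ∪ C) S =
      ∑ s ∈ Finset.Ico s₀ A.card, ∑ t ∈ Finset.range B.card,
        uim {as s t} {bs s t} (Γs s t) S)

/-- The representation with terms `u_θ(s,t)` is `(*,t₀)`-separable. -/
def SepB {α : Type*} [DecidableEq α] (A B C : Finset α)
    (as bs : ℕ → ℕ → α) (Γs : ℕ → ℕ → Finset α) (t₀ : ℕ) : Prop :=
  ∃ B₀ ⊆ B, B₀.card = t₀ ∧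
    (∀ S : Finset α, uim A B₀ C S =
      ∑ s ∈ Finset.range A.card, ∑ t ∈ Finset.range t₀,
        uim {as s t} {bs s t} (Γs s t) S) ∧
    (∀ S : Finset α, uim A (B \ B₀) (B₀ ∪ C) S =
      ∑ s ∈ Finset.range A.card, ∑ t ∈ Finset.Ico t₀ B.card,
        uim {as s t} {bs s t} (Γs s t) S)

section Uim

variable {α : Type*} [DecidableEq α]

lemma uim_comm (A B C : Finset α) : uim A B C = uim B A C := by
  funext S
  unfold uim
  rw [union_comm A B]
  ring

lemma uim_add_uim_sdiff {A₀ A : Finset α} (h : A₀ ⊆ A) (B C S : Finset α) :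
    uim A₀ B C S + uim (A \ A₀) B (A₀ ∪ C) S = uim A B C S := by
  have h1 : A \ A₀ ∪ B ∪ (A₀ ∪ C) = A ∪ B ∪ C := by grind
  have h2 : A \ A₀ ∪ (A₀ ∪ C) = A ∪ C := by grind
  have h3 : B ∪ (A₀ ∪ C) = A₀ ∪ B ∪ C := by grind
  unfold uim
  rw [h1, h2, h3]
  ring

lemma uim_eq_zero {A B C S : Finset α} (h₁ : S ≠ A ∪ B ∪ C) (h₂ : S ≠ C) (h₃ : S ≠ A ∪ C)
    (h₄ : S ≠ B ∪ C) : uim A B C S = 0 := by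
  simp only [uim, if_neg h₁, if_neg h₂, if_neg h₃, if_neg h₄]
  norm_num

lemma uim_eq_sub {A B C S : Finset α} (h₁ : S ≠ A ∪ B ∪ C) (h₃ : S ≠ A ∪ C) :
    uim A B C S = (if S = C then 1 else 0) - (if S = B ∪ C then 1 else 0) := by
  simp only [uim, if_neg h₁, if_neg h₃]
  ring

lemma eq_union_inter {A B C G : Finset α} (hC : C ⊆ G) (hG : G ⊆ A ∪ B ∪ C) :
    G = B ∩ G ∪ (A ∩ G ∪ C) := by
  grind

lemma card_inter_insert {A G : Finset α} {a : α} (ha : a ∈ A) (haG : a ∉ G) :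
    (A ∩ insert a G).card = (A ∩ G).card + 1 := by
  rw [inter_insert_of_mem ha, card_insert_of_notMem (by simp [haG])]

lemma card_inter_insert_of_disjoint {A B G : Finset α} {b : α} (h : Disjoint A B) (hb : b ∈ B) :
    (A ∩ insert b G).card = (A ∩ G).card := by
  rw [inter_insert_of_notMem (disjoint_right.1 h hb)]

end Uim

section Separability

variable {α : Type*} [DecidableEq α] {A B C : Finset α} {as bs : ℕ → ℕ → α}
  {Γs : ℕ → ℕ → Finset α}

lemma IsTermRep.swap (hθ : IsTermRep A B C as bs Γs) :
    IsTermRep B A C (fun s t => bs t s) (fun s t => as t s) (fun s t => Γs t s) := by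
  refine ⟨fun s t hs ht => ?_, fun S => ?_⟩
  · obtain ⟨h1, h2, h3, h4, h5, h6, h7, h8⟩ := hθ.1 t s ht hs
    exact ⟨h2, h1, h3, by rwa [union_comm B A], h6, h5, h8, h7⟩
  · rw [uim_comm, hθ.2 S, sum_comm]
    simp_rw [uim_comm {as _ _}]

lemma sepB_iff_sepA_swap (t₀ : ℕ) :
    SepB A B C as bs Γs t₀ ↔
      SepA B A C (fun s t => bs t s) (fun s t => as t s) (fun s t => Γs t s) t₀ := by
  unfold SepA SepB
  refine exists_congr fun B₀ => and_congr_right fun _ => and_congr_right fun _ =>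
    and_congr (forall_congr' fun S => ?_) (forall_congr' fun S => ?_)
  all_goals
    rw [uim_comm A, sum_comm]
    simp_rw [uim_comm {as _ _}]

/-- The number of elements of `A` in each of the four sets of the term `u_θ(s,t)`. -/
lemma IsTermRep.card_inter (hAB : Disjoint A B) (hθ : IsTermRep A B C as bs Γs) {s t : ℕ}
    (hs : s < A.card) (ht : t < B.card) :
    (A ∩ Γs s t).card = s ∧ (A ∩ ({bs s t} ∪ Γs s t)).card = s ∧
      (A ∩ ({as s t} ∪ Γs s t)).card = s + 1 ∧
      (A ∩ ({as s t} ∪ {bs s t} ∪ Γs s t)).card = s + 1 := by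
  obtain ⟨ha, hb, -, -, haG, -, hcard, -⟩ := hθ.1 s t hs ht
  have hab : as s t ∉ insert (bs s t) (Γs s t) := by
    have : as s t ≠ bs s t := fun h => disjoint_left.1 hAB ha (h ▸ hb)
    simp [this, haG]
  simp only [singleton_union, insert_union]
  refine ⟨hcard, ?_, ?_, ?_⟩
  · rw [card_inter_insert_of_disjoint hAB hb, hcard]
  · rw [card_inter_insert ha haG, hcard]
  · rw [card_inter_insert ha hab, card_inter_insert_of_disjoint hAB hb, hcard]

lemma IsTermRep.term_eq_zero (hAB : Disjoint A B) (hθ : IsTermRep A B C as bs Γs) {s t : ℕ}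
    (hs : s < A.card) (ht : t < B.card) {S : Finset α} (h₀ : (A ∩ S).card ≠ s)
    (h₁ : (A ∩ S).card ≠ s + 1) : uim {as s t} {bs s t} (Γs s t) S = 0 := by
  obtain ⟨k1, k2, k3, k4⟩ := hθ.card_inter hAB hs ht
  apply uim_eq_zero <;> rintro rfl <;> omega

lemma IsTermRep.term_eq_sub (hAB : Disjoint A B) (hθ : IsTermRep A B C as bs Γs) {s t : ℕ}
    (hs : s < A.card) (ht : t < B.card) {S : Finset α} (hS : (A ∩ S).card = s) :
    uim {as s t} {bs s t} (Γs s t) S =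
      (if S = Γs s t then 1 else 0) - (if S = insert (bs s t) (Γs s t) then 1 else 0) := by
  obtain ⟨k1, k2, k3, k4⟩ := hθ.card_inter hAB hs ht
  rw [uim_eq_sub, singleton_union] <;> rintro rfl <;> omega

/-- On sets meeting `A` in `s₀` elements, only the terms with `s = s₀` contribute to the
part of the representation with `s ≥ s₀`. -/
lemma IsTermRep.sum_Ico_eq (hAB : Disjoint A B) (hθ : IsTermRep A B C as bs Γs) {s₀ : ℕ}
    (hs₀ : s₀ < A.card) {S : Finset α} (hS : (A ∩ S).card = s₀) :
    ∑ s ∈ Ico s₀ A.card, ∑ t ∈ range B.card, uim {as s t} {bs s t} (Γs s t) S =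
      ∑ t ∈ range B.card, ((if S = Γs s₀ t then 1 else 0) -
        (if S = insert (bs s₀ t) (Γs s₀ t) then 1 else 0)) := by
  rw [sum_eq_single_of_mem s₀ (by simp [hs₀])]
  · exact sum_congr rfl fun t ht => hθ.term_eq_sub hAB hs₀ (mem_range.1 ht) hS
  · intro s hs hne
    rw [mem_Ico] at hs
    exact sum_eq_zero fun t ht =>
      hθ.term_eq_zero hAB hs.2 (mem_range.1 ht) (by omega) (by omega)

lemma IsTermRep.eq_insert_of_sepA (hAB : Disjoint A B) (hBC : Disjoint B C)
    (hθ : IsTermRep A B C as bs Γs) {s₀ t : ℕ} (hs₀ : s₀ < A.card) (ht : t + 1 < B.card)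
    (h : SepA A B C as bs Γs s₀) :
    Γs s₀ (t + 1) = insert (bs s₀ t) (Γs s₀ t) := by
  obtain ⟨A₀, hA₀, -, -, h2⟩ := h
  have cardB : ∀ t < B.card, (B ∩ Γs s₀ t).card = t := fun t ht => (hθ.1 s₀ t hs₀ ht).2.2.2.2.2.2.2
  have cardB' : ∀ t < B.card, (B ∩ insert (bs s₀ t) (Γs s₀ t)).card = t + 1 := by
    intro t ht
    obtain ⟨-, hb, -, -, -, hbG, -, hcard⟩ := hθ.1 s₀ t hs₀ ht
    rw [card_inter_insert hb hbG, hcard]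
  have cardA := (hθ.1 s₀ (t + 1) hs₀ ht).2.2.2.2.2.2.1
  have hcard := cardB _ ht
  have hzero : uim (A \ A₀) B (A₀ ∪ C) (Γs s₀ (t + 1)) = 0 := by
    have hall : ∀ X : Finset α, B ⊆ X → Γs s₀ (t + 1) ≠ X := by
      rintro X hX rfl
      rw [inter_eq_left.2 hX] at hcard
      omega
    have hnone : ∀ X : Finset α, Disjoint B X → Γs s₀ (t + 1) ≠ X := by
      rintro X hX rfl
      rw [disjoint_iff_inter_eq_empty.1 hX, card_empty] at hcard
      omega
    have hBA₀ : Disjoint B A₀ := (disjoint_of_subset_left hA₀ hAB).symm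
    have hBA₁ : Disjoint B (A \ A₀) := (disjoint_of_subset_left sdiff_subset hAB).symm
    refine uim_eq_zero (hall _ ?_) (hnone _ ?_) (hnone _ ?_) (hall _ ?_)
    · grind
    · simp [hBA₀, hBC]
    · simp [hBA₀, hBA₁, hBC]
    · exact subset_union_left
  rw [h2, hθ.sum_Ico_eq hAB hs₀ cardA, sum_sub_distrib,
    sum_eq_single_of_mem (t + 1) (mem_range.2 ht), sum_eq_single_of_mem t (by simp; omega)] at hzero
  · by_contra hne
    simp [hne] at hzero
  · intro t' ht' hne
    rw [if_neg]
    intro heq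
    have := cardB' t' (mem_range.1 ht')
    rw [← heq] at this
    omega
  · intro t' ht' hne
    rw [if_neg]
    intro heq
    have := cardB t' (mem_range.1 ht')
    rw [← heq] at this
    omega

lemma IsTermRep.sepA_of_eq_insert (hAB : Disjoint A B) (hAC : Disjoint A C)
    (hBne : B.Nonempty) (hθ : IsTermRep A B C as bs Γs) {s₀ : ℕ} (hs₀ : s₀ < A.card)
    (h : ∀ t, t + 1 < B.card → Γs s₀ (t + 1) = insert (bs s₀ t) (Γs s₀ t)) :
    SepA A B C as bs Γs s₀ := by
  have hBpos : 0 < B.card := hBne.card_pos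
  obtain ⟨A₀, hA₀def⟩ : ∃ A₀, A₀ = A ∩ Γs s₀ 0 := ⟨_, rfl⟩
  have hA₀ : A₀ ⊆ A := hA₀def ▸ inter_subset_left
  have hA₀card : A₀.card = s₀ := hA₀def ▸ (hθ.1 s₀ 0 hs₀ hBpos).2.2.2.2.2.2.1
  have hA : ∀ t < B.card, A ∩ Γs s₀ t = A₀ := by
    intro t
    induction t with
    | zero => exact fun _ => hA₀def.symm
    | succ t ih =>
      intro ht
      rw [h t ht, inter_insert_of_notMem, ih (by omega)]
      exact disjoint_right.1 hAB (hθ.1 s₀ t hs₀ (by omega)).2.1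
  have hfirst : Γs s₀ 0 = A₀ ∪ C := by
    obtain ⟨-, -, hC, hsub, -, -, -, hcard⟩ := hθ.1 s₀ 0 hs₀ hBpos
    rw [eq_union_inter hC hsub, card_eq_zero.1 hcard, empty_union, ← hA₀def]
  have hlast : insert (bs s₀ (B.card - 1)) (Γs s₀ (B.card - 1)) = B ∪ (A₀ ∪ C) := by
    obtain ⟨-, hb, hC, hsub, -, hbG, -, hcard⟩ := hθ.1 s₀ (B.card - 1) hs₀ (by omega)
    have hAl := hA (B.card - 1) (by omega)
    have hfull : B ∩ insert (bs s₀ (B.card - 1)) (Γs s₀ (B.card - 1)) = B := by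
      refine eq_of_subset_of_card_le inter_subset_left ?_
      rw [card_inter_insert hb hbG, hcard]
      omega
    have hsub' : insert (bs s₀ (B.card - 1)) (Γs s₀ (B.card - 1)) ⊆ A ∪ B ∪ C :=
      insert_subset (by simp [hb]) hsub
    rw [eq_union_inter (hC.trans (subset_insert _ _)) hsub', hfull,
      inter_insert_of_notMem (disjoint_right.1 hAB hb), hAl]
  have htel : ∀ S : Finset α, ∑ t ∈ range B.card, (((if S = Γs s₀ t then 1 else 0) : ℤ) -
      (if S = insert (bs s₀ t) (Γs s₀ t) then 1 else 0)) =
      (if S = A₀ ∪ C then 1 else 0) - (if S = B ∪ (A₀ ∪ C) then 1 else 0) := by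
    intro S
    obtain ⟨n, hn⟩ : ∃ n, B.card = n + 1 := ⟨B.card - 1, by omega⟩
    rw [hn, Nat.add_sub_cancel] at hlast
    rw [hn, sum_sub_distrib, sum_range_succ', sum_range_succ _ n, hfirst, hlast,
      sum_congr rfl fun t ht => by rw [h t (by simp at ht; omega)]]
    ring
  have card_add : ∀ X : Finset α, A ∩ X = A → (A ∩ X).card = A.card := fun X hX => by rw [hX]
  have cardABC : (A ∩ (A \ A₀ ∪ B ∪ (A₀ ∪ C))).card = A.card := card_add _ (by grind)
  have cardAC : (A ∩ (A \ A₀ ∪ (A₀ ∪ C))).card = A.card := card_add _ (by grind)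
  have inter_A₀ : ∀ X : Finset α, Disjoint A X → (A ∩ (A₀ ∪ X)).card = s₀ := by
    intro X hX
    rw [inter_union_distrib_left, disjoint_iff_inter_eq_empty.1 hX, union_empty,
      inter_eq_right.2 hA₀, hA₀card]
  have cardA₀C : (A ∩ (A₀ ∪ C)).card = s₀ := inter_A₀ _ hAC
  have cardA₀BC : (A ∩ (A₀ ∪ B ∪ C)).card = s₀ := by
    rw [union_assoc]
    exact inter_A₀ _ (by simp [hAB, hAC])
  have cardBA₀C : (A ∩ (B ∪ (A₀ ∪ C))).card = s₀ := by
    rw [← cardA₀BC]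
    congr 2
    grind
  have cardC : (A ∩ C).card = 0 := by rw [disjoint_iff_inter_eq_empty.1 hAC, card_empty]
  have cardBC : (A ∩ (B ∪ C)).card = 0 := by
    rw [inter_union_distrib_left, disjoint_iff_inter_eq_empty.1 hAC,
      disjoint_iff_inter_eq_empty.1 hAB, union_empty, card_empty]
  have hsplit : ∀ S, ∑ s ∈ range s₀, ∑ t ∈ range B.card, uim {as s t} {bs s t} (Γs s t) S +
      ∑ s ∈ Ico s₀ A.card, ∑ t ∈ range B.card, uim {as s t} {bs s t} (Γs s t) S =
      uim A B C S := fun S => by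
    rw [hθ.2 S, sum_range_add_sum_Ico _ hs₀.le]
  have hupper : ∀ S, uim (A \ A₀) B (A₀ ∪ C) S =
      ∑ s ∈ Ico s₀ A.card, ∑ t ∈ range B.card, uim {as s t} {bs s t} (Γs s t) S := by
    intro S
    rcases lt_trichotomy (A ∩ S).card s₀ with hS | hS | hS
    · rw [uim_eq_zero (by rintro rfl; omega) (by rintro rfl; omega) (by rintro rfl; omega)
        (by rintro rfl; omega)]
      refine (sum_eq_zero fun s hs => sum_eq_zero fun t ht => ?_).symm
      rw [mem_Ico] at hs
      exact hθ.term_eq_zero hAB hs.2 (mem_range.1 ht) (by omega) (by omega)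
    · rw [hθ.sum_Ico_eq hAB hs₀ hS, htel,
        uim_eq_sub (by rintro rfl; omega) (by rintro rfl; omega)]
    · have hlow : ∑ s ∈ range s₀, ∑ t ∈ range B.card,
          uim {as s t} {bs s t} (Γs s t) S = 0 := by
        refine sum_eq_zero fun s hs => sum_eq_zero fun t ht => ?_
        rw [mem_range] at hs
        exact hθ.term_eq_zero hAB (by omega) (mem_range.1 ht) (by omega) (by omega)
      have hzero : uim A₀ B C S = 0 := uim_eq_zero (by rintro rfl; omega) (by rintro rfl; omega)
        (by rintro rfl; omega) (by rintro rfl; omega)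
      linarith [hsplit S, uim_add_uim_sdiff hA₀ B C S]
  exact ⟨A₀, hA₀, hA₀card, fun S => by
    linarith [hsplit S, uim_add_uim_sdiff hA₀ B C S, hupper S], hupper⟩

lemma IsTermRep.sepA_iff (hAB : Disjoint A B) (hAC : Disjoint A C) (hBC : Disjoint B C)
    (hBne : B.Nonempty) (hθ : IsTermRep A B C as bs Γs) {s₀ : ℕ} (hs₀ : s₀ < A.card) :
    SepA A B C as bs Γs s₀ ↔ ∀ t, 1 ≤ t → t ≤ B.card - 1 →
      Γs s₀ t = insert (bs s₀ (t - 1)) (Γs s₀ (t - 1)) := by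
  constructor
  · intro h t ht1 ht
    obtain ⟨t, rfl⟩ : ∃ k, t = k + 1 := ⟨t - 1, by omega⟩
    exact hθ.eq_insert_of_sepA hAB hBC hs₀ (by omega) h
  · exact fun h => hθ.sepA_of_eq_insert hAB hAC hBne hs₀
      fun t ht => h (t + 1) (by omega) (by omega)

end Separability

theorem stmt17 {α : Type*} [DecidableEq α] (A B C : Finset α)
    (as bs : ℕ → ℕ → α) (Γs : ℕ → ℕ → Finset α)
    (hAB : Disjoint A B) (hAC : Disjoint A C) (hBC : Disjoint B C)
    (hAne : A.Nonempty) (hBne : B.Nonempty)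
    (hθ : IsTermRep A B C as bs Γs) :
    (∀ s₀, 1 ≤ s₀ → s₀ ≤ A.card - 1 →
      (SepA A B C as bs Γs s₀ ↔
        ∀ t, 1 ≤ t → t ≤ B.card - 1 →
          Γs s₀ t = insert (bs s₀ (t - 1)) (Γs s₀ (t - 1)))) ∧
    (∀ t₀, 1 ≤ t₀ → t₀ ≤ B.card - 1 →
      (SepB A B C as bs Γs t₀ ↔
        ∀ s, 1 ≤ s → s ≤ A.card - 1 →
          Γs s t₀ = insert (as (s - 1) t₀) (Γs (s - 1) t₀))) := by
  have hA := hAne.card_pos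
  have hB := hBne.card_pos
  refine ⟨fun s₀ _ hs₀ => hθ.sepA_iff hAB hAC hBC hBne (by omega), fun t₀ _ ht₀ => ?_⟩
  rw [sepB_iff_sepA_swap, hθ.swap.sepA_iff hAB.symm hBC hAC hAne (by omega)]
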